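/- Let U be a finite nonempty subset of ℝ^d. Then there exists a subset C ⊆ U with |C| ≤ d such that every u ∈ U can be written as u = Σ_{w ∈ C} α_w·w with coefficients α_w ∈ [−1, 1] for all w ∈ C. -/

import Mathlib

open Finset

theorem Module.Basis.det_update_self {ι R M : Type*} [CommRing R] [AddCommGroup M] [Module R M]
    [Fintype ι] [DecidableEq ι] (e : Module.Basis ι R M) (i : ι) (x : M) :
    e.det (Function.update e i x) = e.repr x i := by
  rw [Module.Basis.det_apply, Module.Basis.toMatrix_update, Module.Basis.toMatrix_self,
    ← Matrix.cramer_apply, Matrix.cramer_one, Module.End.one_apply]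

/-- A finite spanning set contains a basis in which all of its elements have coordinates of
absolute value at most one: one maximizing the absolute value of the determinant. -/
theorem Set.Finite.exists_basis_abs_repr_le_one {K V : Type*} [Field K] [LinearOrder K]
    [IsStrictOrderedRing K] [AddCommGroup V] [Module K V] [FiniteDimensional K V]
    {S : Set V} (hfin : S.Finite) (hspan : Submodule.span K S = ⊤) :
    ∃ e : Module.Basis (Fin (Module.finrank K V)) K V,
      (∀ i, e i ∈ S) ∧ ∀ u ∈ S, ∀ i, |e.repr u i| ≤ 1 := by
  have := hfin.to_subtype
  obtain ⟨b, hbS⟩ : ∃ b : Module.Basis (Fin (Module.finrank K V)) K V, ∀ i, b i ∈ S := by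
    let b := Module.Basis.ofSpan hspan.ge
    let σ := Fintype.equivFinOfCardEq (Module.finrank_eq_card_basis b).symm
    exact ⟨b.reindex σ, fun i => by
      rw [Module.Basis.reindex_apply]
      exact Module.Basis.ofSpan_subset hspan.ge (Set.mem_range_self _)⟩
  have : Nonempty (Fin (Module.finrank K V) → S) := ⟨fun i => ⟨b i, hbS i⟩⟩
  obtain ⟨v, hv⟩ := Finite.exists_max
    fun v : Fin (Module.finrank K V) → S => |b.det fun i => (v i : V)|
  have hdet : b.det (fun i => (v i : V)) ≠ 0 := by
    have h := hv fun i => ⟨b i, hbS i⟩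
    rw [show (fun i => ((⟨b i, hbS i⟩ : S) : V)) = b from rfl, b.det_self, abs_one] at h
    exact abs_pos.mp (one_pos.trans_le h)
  obtain ⟨hli, hsp⟩ := b.is_basis_iff_det.mpr hdet.isUnit
  let e := Module.Basis.mk hli hsp.ge
  have he : ⇑e = fun i => (v i : V) := Module.Basis.coe_mk _ _
  refine ⟨e, fun i => he ▸ (v i).2, fun u hu i => ?_⟩
  have h := hv (Function.update v i ⟨u, hu⟩)
  have hupd : (fun j => (Function.update v i ⟨u, hu⟩ j : V)) = Function.update e i u := by
    rw [he]
    exact Function.comp_update Subtype.val v i ⟨u, hu⟩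
  rw [hupd, b.det.eq_smul_basis_det e, AlternatingMap.smul_apply, AlternatingMap.smul_apply,
    e.det_update_self, ← he, e.det_self, smul_eq_mul, smul_eq_mul, mul_one, abs_mul] at h
  exact le_of_mul_le_mul_left (h.trans_eq (mul_one _).symm) (abs_pos.mpr (he ▸ hdet))

/-- **Existence of a barycentric spanner** (Awerbuch–Kleinberg): every finite
nonempty set `U ⊆ ℝ^d` contains a subset `C` of cardinality at most `d` such
that every `u ∈ U` is a linear combination of the elements of `C` with all
coefficients in `[−1, 1]`. -/
theorem exists_barycentric_spanner {d : ℕ} (U : Finset (Fin d → ℝ))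
    (hU : U.Nonempty) :
    ∃ C : Finset (Fin d → ℝ), C ⊆ U ∧ C.card ≤ d ∧
      ∀ u ∈ U, ∃ α : (Fin d → ℝ) → ℝ,
        (∀ w ∈ C, α w ∈ Set.Icc (-1 : ℝ) 1) ∧ u = ∑ w ∈ C, α w • w := by
  have hspan : Submodule.span ℝ
      ((↑) ⁻¹' (U : Set (Fin d → ℝ)) : Set (Submodule.span ℝ (U : Set (Fin d → ℝ)))) = ⊤ :=
    Submodule.span_span_coe_preimage
  obtain ⟨e, heU, he⟩ := (U.finite_toSet.preimage
    Subtype.val_injective.injOn).exists_basis_abs_repr_le_one hspan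
  have hinj : Function.Injective fun i => (e i : Fin d → ℝ) :=
    Subtype.val_injective.comp e.injective
  refine ⟨univ.image fun i => (e i : Fin d → ℝ), ?_, ?_, fun u hu => ?_⟩
  · exact image_subset_iff.mpr fun i _ => heU i
  · refine card_image_le.trans ?_
    simpa using Submodule.finrank_le (Submodule.span ℝ (U : Set (Fin d → ℝ)))
  · let x : Submodule.span ℝ (U : Set (Fin d → ℝ)) := ⟨u, Submodule.subset_span hu⟩
    refine ⟨Function.extend (fun i => (e i : Fin d → ℝ)) (e.repr x) 0, ?_, ?_⟩
    · intro w hw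
      obtain ⟨i, -, rfl⟩ := mem_image.mp hw
      rw [hinj.extend_apply]
      exact abs_le.mp (he x hu i)
    · rw [sum_image hinj.injOn]
      simp_rw [hinj.extend_apply]
      have h := congrArg (Submodule.subtype _) (e.sum_repr x)
      rw [map_sum] at h
      exact h.symm
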